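/- arXiv:2505.07137 — 2 statements merged into one kernel-verified Lean document; each statement's English description precedes it below -/
import Mathlib

section
/- Let d ≥ 2 and let f ∈ PL(d,n), i.e. f : ℝ^d → ℝ is a continuous compactly supported function that is affine on each of at most n d-simplices with pairwise disjoint interiors and zero outside their union. Then there exist an integer m ≤ 2n, signs ε_1, …, ε_m ∈ {−1, +1}, integers k_1, …, k_m with each k_i ≤ d², and affine functions g_{i,1}, …, g_{i,k_i} : ℝ^d → ℝ for each i, such that for every x ∈ ℝ^d one has f(x) = Σ_{i=1}^m ε_i · max(0, min_{1≤j≤k_i} g_{i,j}(x)). -/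
open MeasureTheory

noncomputable section

/-- Orthogonal projection ℝ^{d+1} → ℝ^d forgetting the last coordinate. -/
def proj (d : ℕ) (y : Fin (d + 1) → ℝ) : Fin d → ℝ := fun i => y i.castSucc

/-- `v` lists the `d+2` vertices of a nondegenerate `(d+1)`-simplex in `ℝ^{d+1}`:
the vertices are affinely independent (so the simplex is full dimensional), and for each
vertex `i` the projection of the opposite `d`-dimensional face is a full dimensional
`d`-simplex in `ℝ^d` (its projected vertices are affinely independent). -/
def IsNondegSimplex (d : ℕ) (v : Fin (d + 2) → (Fin (d + 1) → ℝ)) : Prop :=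
  AffineIndependent ℝ v ∧
    ∀ i : Fin (d + 2),
      AffineIndependent ℝ (fun j : {j : Fin (d + 2) // j ≠ i} => proj d (v j.1))

/-- The simplex function `τ(Δ)`: the length (1-dimensional Lebesgue measure) of the
intersection of the vertical line over `x` with the simplex with vertices `v`. -/
def simplexFn (d : ℕ) (v : Fin (d + 2) → (Fin (d + 1) → ℝ)) (x : Fin d → ℝ) : ℝ :=
  (volume {t : ℝ | Fin.snoc x t ∈ convexHull ℝ (Set.range v)}).toReal

/-- `f ∈ PL(d,n)`: `f : ℝ^d → ℝ` is continuous with compact support, and there are at most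
`n` full-dimensional `d`-simplices in `ℝ^d` with pairwise disjoint interiors such that `f`
is affine on each of them and vanishes outside their union. -/
def IsPL (d n : ℕ) (f : (Fin d → ℝ) → ℝ) : Prop :=
  Continuous f ∧ HasCompactSupport f ∧
    ∃ (m : ℕ) (_ : m ≤ n) (w : Fin m → Fin (d + 1) → (Fin d → ℝ)),
      (∀ i, AffineIndependent ℝ (w i)) ∧
      (Pairwise fun i j =>
        interior (convexHull ℝ (Set.range (w i))) ∩
          interior (convexHull ℝ (Set.range (w j))) = ∅) ∧
      (∀ i, ∃ g : (Fin d → ℝ) →ᵃ[ℝ] ℝ,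
        ∀ x ∈ convexHull ℝ (Set.range (w i)), f x = g x) ∧
      (∀ x : Fin d → ℝ, x ∉ ⋃ i, convexHull ℝ (Set.range (w i)) → f x = 0)


lemma aff_ray {E : Type*} [AddCommGroup E] [Module ℝ E] (g : E →ᵃ[ℝ] ℝ) (p x : E) (t : ℝ)
    (ht : t ≠ 0) : t * g (p + t⁻¹ • (x - p)) = t * g p + (g x - g p) := by
  have h1 : g (p + t⁻¹ • (x - p)) = t⁻¹ * (g x - g p) + g p := by
    have h2 : p + t⁻¹ • (x - p) = AffineMap.lineMap p x t⁻¹ := by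
      rw [AffineMap.lineMap_apply_module', add_comm]
    rw [h2, AffineMap.apply_lineMap, AffineMap.lineMap_apply_module']
    simp
  rw [h1]
  field_simp
  ring

/-- The parameters `t ∈ (0,1)` for which `p + t⁻¹ (x - p)` is interior to the simplex. -/
def raySet {d : ℕ} (b : AffineBasis (Fin (d + 1)) ℝ (Fin d → ℝ)) (p x : Fin d → ℝ) : Set ℝ :=
  {t | 0 < t ∧ t < 1 ∧ ∀ j, 0 < t * b.coord j p + (b.coord j x - b.coord j p)}

lemma raySet_meas {d : ℕ} (b : AffineBasis (Fin (d + 1)) ℝ (Fin d → ℝ)) (p x : Fin d → ℝ) :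
    MeasurableSet (raySet b p x) := by
  apply IsOpen.measurableSet
  have : raySet b p x = Set.Ioi 0 ∩ (Set.Iio 1 ∩
      ⋂ j, {t : ℝ | 0 < t * b.coord j p + (b.coord j x - b.coord j p)}) := by
    ext t; simp [raySet]
  rw [this]
  refine isOpen_Ioi.inter (isOpen_Iio.inter (isOpen_iInter_of_finite fun j => ?_))
  exact isOpen_lt continuous_const (by fun_prop)

lemma raySet_len {d : ℕ} (hd : 2 ≤ d) (b : AffineBasis (Fin (d + 1)) ℝ (Fin d → ℝ))
    (p : Fin d → ℝ) (hp : ∀ j, b.coord j p ≠ 0) (c : ℝ) (hc : 0 ≤ c) :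
    ∃ (k : ℕ) (hk : 1 ≤ k) (g : Fin k → ((Fin d → ℝ) →ᵃ[ℝ] ℝ)), k ≤ d ^ 2 ∧
      ∀ x, max 0 (Finset.univ.inf'
            (Finset.univ_nonempty_iff.mpr (Fin.pos_iff_nonempty.mp hk))
            (fun j => g j x)) = c * volume.real (raySet b p x) := by
  classical
  let Pos := {j : Fin (d + 1) // 0 < b.coord j p}
  let Neg := {j : Fin (d + 1) // ¬ 0 < b.coord j p}
  have hPos : Nonempty Pos := by
    by_contra h
    have h1 : ∀ j, b.coord j p ≤ 0 := fun j => by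
      by_contra h2
      exact h ⟨⟨j, not_le.mp h2⟩⟩
    have h2 := b.sum_coord_apply_eq_one p
    have h3 := Finset.sum_nonpos (s := Finset.univ) (fun j _ => h1 j)
    linarith
  let A : Fin (d + 1) → ((Fin d → ℝ) →ᵃ[ℝ] ℝ) := fun j => (b.coord j p)⁻¹ • b.coord j
  let U : Option Neg → ((Fin d → ℝ) →ᵃ[ℝ] ℝ) := fun o => o.elim 0 (fun j => A j.1)
  let e := Fintype.equivFin (Pos × Option Neg)
  have hcard : Fintype.card Pos + Fintype.card Neg = d + 1 := by
    have := Fintype.card_subtype_compl (fun j : Fin (d + 1) => 0 < b.coord j p)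
    have h2 := Fintype.card_subtype_le (fun j : Fin (d + 1) => 0 < b.coord j p)
    simp only [Fintype.card_fin] at this h2
    simp only [Pos, Neg]
    omega
  refine ⟨Fintype.card (Pos × Option Neg), Fintype.card_pos,
    fun i => c • (A (e.symm i).1.1 - U (e.symm i).2), ?_, ?_⟩
  · rw [Fintype.card_prod, Fintype.card_option]
    generalize Fintype.card Pos = u at *
    generalize Fintype.card Neg = v at *
    zify at *
    nlinarith [sq_nonneg ((u : ℤ) - (v + 1))]
  · intro x
    obtain ⟨j0, hj0⟩ := Finite.exists_min (fun j : Pos => A j.1 x)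
    obtain ⟨o0, ho0⟩ := Finite.exists_max (fun o : Option Neg => U o x)
    have hinf : Finset.univ.inf' (Finset.univ_nonempty_iff.mpr
        (Fin.pos_iff_nonempty.mp (Fintype.card_pos (α := Pos × Option Neg))))
        (fun i => (c • (A (e.symm i).1.1 - U (e.symm i).2)) x) = c * (A j0.1 x - U o0 x) := by
      apply le_antisymm
      · refine (Finset.inf'_le _ (Finset.mem_univ (e (j0, o0)))).trans ?_
        simp
      · refine Finset.le_inf' _ _ fun i _ => ?_
        have h1 := hj0 (e.symm i).1
        have h2 := ho0 (e.symm i).2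
        change _ ≤ c * (A (e.symm i).1.1 x - U (e.symm i).2 x)
        apply mul_le_mul_of_nonneg_left _ hc
        linarith
    rw [hinf]
    have hset : raySet b p x = Set.Ioo (1 - A j0.1 x) (1 - U o0 x) := by
      have hA : ∀ j t, t * b.coord j p + (b.coord j x - b.coord j p) =
          b.coord j p * (t - (1 - A j x)) := by
        intro j t
        have := hp j
        simp only [A, AffineMap.coe_smul, Pi.smul_apply, smul_eq_mul]
        field_simp
        ring
      ext t
      constructor
      · rintro ⟨h0, h1, h2⟩
        constructor
        · have := h2 j0.1
          rw [hA] at this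
          have := (pos_iff_pos_of_mul_pos this).mp j0.2
          linarith
        · rcases o0 with _ | j
          · simpa [U] using h1
          · have := h2 j.1
            rw [hA] at this
            have hn := lt_of_le_of_ne (not_lt.mp j.2) (hp j.1)
            have := (neg_iff_neg_of_mul_pos this).mp hn
            change t < 1 - A j.1 x
            linarith
      · rintro ⟨h0, h1⟩
        have h2 : ∀ j, 0 < t * b.coord j p + (b.coord j x - b.coord j p) := by
          intro j
          rw [hA]
          by_cases hj : 0 < b.coord j p
          · have : A j0.1 x ≤ A j x := hj0 ⟨j, hj⟩
            apply mul_pos hj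
            linarith
          · have : A j x ≤ U o0 x := ho0 (some ⟨j, hj⟩)
            apply mul_pos_of_neg_of_neg (lt_of_le_of_ne (not_lt.mp hj) (hp j))
            linarith
        refine ⟨?_, ?_, h2⟩
        · have h3 := Finset.sum_pos (s := Finset.univ) (fun j _ => h2 j) Finset.univ_nonempty
          rw [Finset.sum_add_distrib, Finset.sum_sub_distrib, ← Finset.mul_sum,
            b.sum_coord_apply_eq_one, b.sum_coord_apply_eq_one] at h3
          linarith
        · have : (0 : ℝ) ≤ U o0 x := ho0 none
          linarith
    rw [hset, Real.volume_real_Ioo, mul_max_of_nonneg _ _ hc, max_comm, mul_zero]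
    congr 2
    ring

lemma exists_generic {d m : ℕ} (b : Fin m → AffineBasis (Fin (d + 1)) ℝ (Fin d → ℝ)) :
    ∃ p, ∀ i j, (b i).coord j p ≠ 0 := by
  have h : ∀ᵐ p : Fin d → ℝ, ∀ i j, (b i).coord j p ≠ 0 := by
    rw [ae_all_iff]; intro i
    rw [ae_all_iff]; intro j
    have := Measure.addHaar_affineSubspace (volume : Measure (Fin d → ℝ))
      ((AffineSubspace.mk' (0 : ℝ) ⊥).comap ((b i).coord j)) (by
        intro h
        have h1 : (b i) j ∈ ((AffineSubspace.mk' (0 : ℝ) ⊥).comap ((b i).coord j)) := by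
          rw [h]; trivial
        simp [AffineSubspace.mem_comap] at h1)
    rw [ae_iff]
    convert this using 2
    ext p
    simp [AffineSubspace.mem_comap]
  exact h.exists

lemma ray_formula {d m : ℕ} (f : (Fin d → ℝ) → ℝ) (hf : Continuous f) (hcs : HasCompactSupport f)
    (b : Fin m → AffineBasis (Fin (d + 1)) ℝ (Fin d → ℝ))
    (hdis : Pairwise fun i j =>
        interior (convexHull ℝ (Set.range (b i))) ∩
          interior (convexHull ℝ (Set.range (b j))) = ∅)
    (g : Fin m → ((Fin d → ℝ) →ᵃ[ℝ] ℝ))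
    (hg : ∀ i, ∀ x ∈ convexHull ℝ (Set.range (b i)), f x = g i x)
    (h0 : ∀ x : Fin d → ℝ, x ∉ ⋃ i, convexHull ℝ (Set.range (b i)) → f x = 0)
    (p : Fin d → ℝ) (hp : ∀ i j, (b i).coord j p ≠ 0) (x : Fin d → ℝ) :
    f x = ∑ i, g i p * volume.real (raySet (b i) p x) := by
  classical
  let y : ℝ → (Fin d → ℝ) := fun t => p + t⁻¹ • (x - p)
  let q : ℝ → ℝ := fun t => t * f (y t)
  let q' : ℝ → ℝ := fun t => ∑ i, (raySet (b i) p x).indicator (fun _ => g i p) t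
  have hyc : ∀ t, t ≠ 0 → ContinuousAt y t := by
    intro t ht
    exact continuousAt_const.add ((continuousAt_inv₀ ht).smul continuousAt_const)
  have hq : Continuous q := by
    rw [continuous_iff_continuousAt]
    intro t
    by_cases ht : t = 0
    · subst ht
      obtain ⟨C, hC⟩ := hcs.exists_bound_of_continuous hf
      have hq0 : q 0 = 0 := by simp [q]
      rw [ContinuousAt, hq0]
      apply squeeze_zero_norm (a := fun t : ℝ => |t| * C)
      · intro t
        simp only [q, norm_mul, Real.norm_eq_abs]
        exact mul_le_mul_of_nonneg_left (hC _) (abs_nonneg _)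
      · have : Continuous (fun t : ℝ => |t| * C) := by fun_prop
        simpa using this.tendsto 0
    · exact continuousAt_id.mul (ContinuousAt.comp hf.continuousAt (hyc t ht))
  have hint : ∀ i, IntegrableOn ((raySet (b i) p x).indicator (fun _ => g i p)) (Set.Ioc 0 1) := by
    intro i
    exact (integrable_const (μ := volume.restrict (Set.Ioc (0 : ℝ) 1)) (g i p)).indicator (raySet_meas _ _ _)
  have hint' : IntervalIntegrable q' volume 0 1 := by
    rw [intervalIntegrable_iff_integrableOn_Ioc_of_le zero_le_one]
    exact integrable_finsetSum _ fun i _ => hint i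
  let s : Set ℝ := ⋃ i, ⋃ j, {1 - (b i).coord j x / (b i).coord j p}
  have hs : s.Countable :=
    Set.countable_iUnion fun i => Set.countable_iUnion fun j => Set.countable_singleton _
  have hder : ∀ t ∈ Set.Ioo (0 : ℝ) 1 \ s, HasDerivAt q (q' t) t := by
    rintro t ⟨⟨ht0, ht1⟩, hts⟩
    have hne : ∀ i j, t * (b i).coord j p + ((b i).coord j x - (b i).coord j p) ≠ 0 := by
      intro i j h
      apply hts
      simp only [s, Set.mem_iUnion, Set.mem_singleton_iff]
      refine ⟨i, j, ?_⟩
      have := hp i j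
      field_simp
      linarith
    have hray : ∀ i, t ∈ raySet (b i) p x ↔ y t ∈ interior (convexHull ℝ (Set.range (b i))) := by
      intro i
      rw [AffineBasis.interior_convexHull]
      simp only [raySet, Set.mem_setOf_eq, ht0, ht1, true_and]
      refine forall_congr' fun j => ?_
      rw [← aff_ray ((b i).coord j) p x t ht0.ne']
      exact mul_pos_iff_of_pos_left ht0
    have hty := hyc t ht0.ne'
    have hpos : ∀ᶠ u in nhds t, (0 : ℝ) < u := lt_mem_nhds ht0
    by_cases hex : ∃ i, t ∈ raySet (b i) p x
    · obtain ⟨i, hi⟩ := hex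
      have hq' : q' t = g i p := by
        simp only [q']
        rw [Finset.sum_eq_single i]
        · simp [hi]
        · intro k _ hk
          apply Set.indicator_of_notMem
          intro hk'
          have : y t ∈ (∅ : Set (Fin d → ℝ)) := by
            rw [← hdis hk]
            exact ⟨(hray k).1 hk', (hray i).1 hi⟩
          exact this
        · simp
      rw [hq']
      have hev : q =ᶠ[nhds t] fun u => u * g i p + (g i x - g i p) := by
        filter_upwards [hpos, hty (isOpen_interior.mem_nhds ((hray i).1 hi))] with u hu hu2
        simp only [q]
        rw [hg i _ (interior_subset hu2)]
        exact aff_ray (g i) p x u hu.ne'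
      refine HasDerivAt.congr_of_eventuallyEq ?_ hev
      simpa using ((hasDerivAt_id t).mul_const (g i p)).add_const (g i x - g i p)
    · push Not at hex
      have hq' : q' t = 0 := by
        simp only [q']
        exact Finset.sum_eq_zero fun i _ => Set.indicator_of_notMem (hex i) _
      rw [hq']
      have hcl : IsClosed (⋃ i, convexHull ℝ (Set.range (b i))) :=
        isClosed_iUnion_of_finite fun i => (Set.finite_range (b i)).isClosed_convexHull ℝ
      have hout : y t ∈ (⋃ i, convexHull ℝ (Set.range (b i)))ᶜ := by
        simp only [Set.mem_compl_iff, Set.mem_iUnion, not_exists]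
        intro i hi
        apply hex i
        refine ⟨ht0, ht1, fun j => lt_of_le_of_ne ?_ (hne i j).symm⟩
        rw [AffineBasis.convexHull_eq_nonneg_coord] at hi
        rw [← aff_ray ((b i).coord j) p x t ht0.ne']
        exact mul_nonneg ht0.le (hi j)
      have hev : q =ᶠ[nhds t] fun u => 0 := by
        filter_upwards [hty (hcl.isOpen_compl.mem_nhds hout)] with u hu2
        simp only [q]
        rw [h0 _ hu2, mul_zero]
      exact HasDerivAt.congr_of_eventuallyEq (hasDerivAt_const t 0) hev
  have hmain := integral_eq_of_hasDerivAt_off_countable_of_le q q' zero_le_one hs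
    hq.continuousOn hder hint'
  have hq1 : q 1 - q 0 = f x := by simp [q, y]
  rw [← hq1, ← hmain, intervalIntegral.integral_of_le zero_le_one]
  simp only [q']
  rw [integral_finsetSum _ fun i _ => hint i]
  refine Finset.sum_congr rfl fun i _ => ?_
  have hsub : raySet (b i) p x ⊆ Set.Ioc 0 1 := fun t ht => ⟨ht.1, ht.2.1.le⟩
  rw [setIntegral_indicator (raySet_meas _ _ _), Set.inter_eq_self_of_subset_right hsub]
  simp [mul_comm]

/-- Any `f ∈ PL(d,n)` (with `d ≥ 2`) is a signed sum of at most `2n` terms, each of which is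
the positive part of a minimum of at most `d²` affine functions. -/
theorem pl_eq_signed_sum_max_min (d n : ℕ) (hd : 2 ≤ d)
    (f : (Fin d → ℝ) → ℝ) (hf : IsPL d n f) :
    ∃ (m : ℕ) (_ : m ≤ 2 * n) (ε : Fin m → ℝ) (k : Fin m → ℕ)
      (hk : ∀ i, 1 ≤ k i)
      (g : (i : Fin m) → Fin (k i) → ((Fin d → ℝ) →ᵃ[ℝ] ℝ)),
      (∀ i, ε i = 1 ∨ ε i = -1) ∧
      (∀ i, k i ≤ d ^ 2) ∧
      (∀ x : Fin d → ℝ,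
        f x = ∑ i, ε i *
          max 0 (Finset.univ.inf'
            (Finset.univ_nonempty_iff.mpr (Fin.pos_iff_nonempty.mp (hk i)))
            (fun j => g i j x))) := by
  obtain ⟨hfc, hcs, m, hm, w, hw, hdis, hg, h0⟩ := hf
  choose a ha using hg
  let b : Fin m → AffineBasis (Fin (d + 1)) ℝ (Fin d → ℝ) := fun i =>
    ⟨w i, hw i, by
      rw [(hw i).affineSpan_eq_top_iff_card_eq_finrank_add_one]; simp⟩
  obtain ⟨p, hp⟩ := exists_generic b
  have key := ray_formula f hfc hcs b hdis a ha h0 p hp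
  choose k hk g hkd hg using fun i =>
    raySet_len hd (b i) p (hp i) |a i p| (abs_nonneg _)
  refine ⟨m, by omega, fun i => if 0 ≤ a i p then 1 else -1, k, hk, g, ?_, hkd, ?_⟩
  · intro i
    dsimp only
    split_ifs <;> simp
  · intro x
    rw [key x]
    refine Finset.sum_congr rfl fun i _ => ?_
    rw [hg i x]
    dsimp only
    split_ifs with h
    · rw [abs_of_nonneg h]; ring
    · rw [abs_of_neg (not_le.mp h)]; ring
end
end

section
/- A function f : ℝ^d → ℝ is a continuous, compactly supported, piecewise affine function (i.e. f ∈ PL(d,n) for some n) if and only if f can be written as a finite signed sum of simplex functions: there exist finitely many nondegenerate (d+1)-simplices Δ_1, …, Δ_m in ℝ^{d+1} and signs ε_1, …, ε_m ∈ {−1, +1} with f = Σ_{i=1}^m ε_i τ(Δ_i). -/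
open MeasureTheory

noncomputable section

/-! ### Basic facts on affine maps and affine bases -/

lemma aff_sum {ι V : Type*} [Fintype ι] [AddCommGroup V] [Module ℝ V] (φ : V →ᵃ[ℝ] ℝ)
    (μ : ι → ℝ) (p : ι → V) :
    ∑ k, μ k * φ (p k) = φ.linear (∑ k, μ k • p k) + (∑ k, μ k) * φ 0 := by
  have h : ∀ x, φ x = φ.linear x + φ 0 := fun x => congrFun φ.decomp x
  simp_rw [map_sum, map_smul, Finset.sum_mul, ← Finset.sum_add_distrib]
  refine Finset.sum_congr rfl fun k _ => ?_
  rw [h (p k), smul_eq_mul]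
  ring

lemma aff_eval {ι V : Type*} [Fintype ι] [AddCommGroup V] [Module ℝ V] (b : AffineBasis ι ℝ V)
    (φ : V →ᵃ[ℝ] ℝ) (x : V) : φ x = ∑ k, b.coord k x * φ (b k) := by
  rw [aff_sum, b.linear_combination_coord_eq_self, b.sum_coord_apply_eq_one, one_mul]
  exact congrFun φ.decomp x

lemma affInd_of {ι V : Type*} [Fintype ι] [AddCommGroup V] [Module ℝ V] (p : ι → V)
    (H : ∀ μ : ι → ℝ, ∑ i, μ i = 0 → ∑ i, μ i • p i = 0 → ∀ i, μ i = 0) :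
    AffineIndependent ℝ p := by
  rw [affineIndependent_iff_of_fintype]
  intro w hw h
  refine H w hw ?_
  rwa [Finset.weightedVSub_eq_linear_combination _ hw] at h

lemma exists_basis {n : ℕ} (w : Fin (n + 1) → (Fin n → ℝ)) (hw : AffineIndependent ℝ w) :
    ∃ b : AffineBasis (Fin (n + 1)) ℝ (Fin n → ℝ), ⇑b = w :=
  ⟨⟨w, hw, by rw [hw.affineSpan_eq_top_iff_card_eq_finrank_add_one]; simp⟩, rfl⟩

lemma hull_eq {n : ℕ} (b : AffineBasis (Fin (n + 1)) ℝ (Fin n → ℝ)) (x : Fin n → ℝ) :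
    x ∈ convexHull ℝ (Set.range b) ↔ ∀ i, 0 ≤ b.coord i x := by
  rw [b.convexHull_eq_nonneg_coord]; rfl

lemma int_hull_eq {n : ℕ} (b : AffineBasis (Fin (n + 1)) ℝ (Fin n → ℝ)) (x : Fin n → ℝ) :
    x ∈ interior (convexHull ℝ (Set.range b)) ↔ ∀ i, 0 < b.coord i x := by
  rw [b.interior_convexHull]; rfl

/-! ### Cutting a simplex by a hyperplane -/

lemma cut_half {n : ℕ} (b : AffineBasis (Fin (n + 1)) ℝ (Fin n → ℝ)) (i j : Fin (n + 1))
    (hij : i ≠ j) (α β : ℝ) (hα : 0 < α) (hβ : 0 < β) (hαβ : α + β = 1) :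
    AffineIndependent ℝ (Function.update b i (α • b i + β • b j)) ∧
    (∀ x, x ∈ convexHull ℝ (Set.range (Function.update b i (α • b i + β • b j))) ↔
      x ∈ convexHull ℝ (Set.range b) ∧ 0 ≤ α * b.coord j x - β * b.coord i x) ∧
    (∀ x ∈ interior (convexHull ℝ (Set.range (Function.update b i (α • b i + β • b j)))),
      0 < α * b.coord j x - β * b.coord i x) := by
  classical
  set w := Function.update b i (α • b i + β • b j) with hw
  set L : (Fin n → ℝ) →ᵃ[ℝ] ℝ := α • b.coord j - β • b.coord i with hL
  have hLx : ∀ x, L x = α * b.coord j x - β * b.coord i x := fun x => rfl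
  have hr : ∀ k, b.coord k (α • b i + β • b j) = α * b.coord k (b i) + β * b.coord k (b j) := by
    intro k
    have := Convex.combo_affine_apply (f := b.coord k) (x := b i) (y := b j) hαβ
    simpa using this
  have hwi : w i = α • b i + β • b j := by simp [hw]
  have hwk : ∀ k, k ≠ i → w k = b k := fun k hk => by simp [hw, hk]
  -- the relevant functions on the vertices of `w`
  have f1 : ∀ k, b.coord i (w k) = if k = i then α else 0 := by
    intro k
    split_ifs with h
    · subst h; rw [hwi, hr]; simp [b.coord_apply_ne hij]
    · rw [hwk k h, b.coord_apply_ne (Ne.symm h)]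
  have f2 : ∀ l, l ≠ i → l ≠ j → ∀ k, b.coord l (w k) = if k = l then 1 else 0 := by
    intro l hli hlj k
    by_cases h : k = i
    · subst h; rw [hwi, hr, b.coord_apply_ne hli, b.coord_apply_ne hlj, if_neg (Ne.symm hli)]; ring
    · rw [hwk k h, b.coord_apply]; simp [eq_comm]
  have f3 : ∀ k, L (w k) = if k = j then α else 0 := by
    intro k
    rw [hLx]
    by_cases h : k = i
    · subst h; rw [hwi, hr, hr, if_neg hij]; simp [b.coord_apply_ne hij, b.coord_apply_ne hij.symm]
      ring
    · rw [hwk k h, b.coord_apply, b.coord_apply, if_neg (Ne.symm h)]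
      simp [eq_comm]
  have hind : AffineIndependent ℝ w := by
    refine affInd_of _ fun μ h0 h1 l => ?_
    have key : ∀ φ : (Fin n → ℝ) →ᵃ[ℝ] ℝ, ∑ k, μ k * φ (w k) = 0 := by
      intro φ; rw [aff_sum, h0, h1]; simp
    by_cases hli : l = i
    · have := key (b.coord i)
      simp_rw [f1] at this
      simp at this
      rw [hli]; exact this.resolve_right hα.ne'
    by_cases hlj : l = j
    · have := key L
      simp_rw [f3] at this
      simp at this
      rw [hlj]; exact this.resolve_right hα.ne'
    · have := key (b.coord l)
      simp_rw [f2 l hli hlj] at this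
      simpa using this
  obtain ⟨c, hc⟩ := exists_basis w hind
  have g1 : ∀ x, b.coord i x = c.coord i x * α := by
    intro x; rw [aff_eval c (b.coord i), hc]; simp_rw [f1]; simp
  have g2 : ∀ l, l ≠ i → l ≠ j → ∀ x, b.coord l x = c.coord l x := by
    intro l h1 h2 x; rw [aff_eval c (b.coord l), hc]; simp_rw [f2 l h1 h2]; simp
  have g3 : ∀ x, L x = c.coord j x * α := by
    intro x; rw [aff_eval c L, hc]; simp_rw [f3]; simp
  refine ⟨hind, fun x => ?_, fun x hx => ?_⟩
  · rw [← hc, hull_eq, hull_eq, ← hLx, g3]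
    constructor
    · intro h
      have hi := h i
      have hj := h j
      have e1 := g1 x
      have e3 := g3 x
      rw [hLx] at e3
      refine ⟨fun l => ?_, by positivity⟩
      by_cases hli : l = i
      · rw [hli, e1]; positivity
      by_cases hlj : l = j
      · rw [hlj]
        have : α * b.coord j x = c.coord j x * α + β * (c.coord i x * α) := by rw [← e1]; linarith
        have h2 : 0 ≤ α * b.coord j x := by rw [this]; positivity
        exact nonneg_of_mul_nonneg_right h2 hα
      · rw [g2 l hli hlj]; exact h l
    · rintro ⟨h, h'⟩ l
      by_cases hli : l = i
      · have := h i
        rw [g1] at this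
        rw [hli]; exact nonneg_of_mul_nonneg_left this hα
      by_cases hlj : l = j
      · rw [hlj]; exact nonneg_of_mul_nonneg_left h' hα
      · rw [← g2 l hli hlj]; exact h l
  · rw [← hc, int_hull_eq] at hx
    rw [← hLx, g3]
    exact mul_pos (hx j) hα

/-- `S` is a finite dissection of the simplex `w` into simplices on which all maps in `H` have
a definite sign. -/
def Dissects {n : ℕ} (H : Set ((Fin n → ℝ) →ᵃ[ℝ] ℝ)) (w : Fin (n + 1) → (Fin n → ℝ))
    (S : Set (Fin (n + 1) → (Fin n → ℝ))) : Prop :=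
  S.Finite ∧ (∀ u ∈ S, AffineIndependent ℝ u) ∧
  (S.Pairwise fun u u' => interior (convexHull ℝ (Set.range u)) ∩
          interior (convexHull ℝ (Set.range u')) = ∅) ∧
  (⋃ u ∈ S, convexHull ℝ (Set.range u)) = convexHull ℝ (Set.range w) ∧
  ∀ u ∈ S, ∀ h ∈ H, (∀ x ∈ convexHull ℝ (Set.range u), 0 ≤ h x) ∨
    (∀ x ∈ convexHull ℝ (Set.range u), h x ≤ 0)

lemma aff_hull_nonneg {n : ℕ} {ι : Type*} (u : ι → (Fin n → ℝ)) (h : (Fin n → ℝ) →ᵃ[ℝ] ℝ)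
    (hu : ∀ k, 0 ≤ h (u k)) : ∀ x ∈ convexHull ℝ (Set.range u), 0 ≤ h x := by
  have : convexHull ℝ (Set.range u) ⊆ h ⁻¹' Set.Ici 0 := by
    refine convexHull_min ?_ ((convex_Ici 0).affine_preimage h)
    rintro _ ⟨k, rfl⟩; exact hu k
  exact fun x hx => this hx

lemma dissect_one {n : ℕ} (h : (Fin n → ℝ) →ᵃ[ℝ] ℝ) (N : ℕ) :
    ∀ w : Fin (n + 1) → (Fin n → ℝ), AffineIndependent ℝ w →
      (Finset.univ.filter fun k => h (w k) ≠ 0).card ≤ N → ∃ S, Dissects {h} w S := by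
  classical
  induction N with
  | zero =>
    intro w hw hN
    refine ⟨{w}, Set.finite_singleton _, by simpa using hw, by simp, by simp, ?_⟩
    simp only [Set.mem_singleton_iff, forall_eq]
    left
    refine aff_hull_nonneg w h fun k => ?_
    by_contra hk
    have : k ∈ Finset.univ.filter fun k => h (w k) ≠ 0 := by
      simp; intro h0; rw [h0] at hk; exact hk le_rfl
    have := Finset.card_pos.2 ⟨k, this⟩
    omega
  | succ N ih =>
    intro w hw hN
    by_cases hs : (∀ k, 0 ≤ h (w k)) ∨ (∀ k, h (w k) ≤ 0)
    · refine ⟨{w}, Set.finite_singleton _, by simpa using hw, by simp, by simp, ?_⟩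
      simp only [Set.mem_singleton_iff, forall_eq]
      rcases hs with hs | hs
      · exact Or.inl (aff_hull_nonneg w h hs)
      · right
        intro x hx
        have := aff_hull_nonneg w (-h) (fun k => by simpa using hs k) x hx
        simpa using this
    push Not at hs
    obtain ⟨⟨j, hj⟩, ⟨i, hi⟩⟩ := hs
    have hij : i ≠ j := by rintro rfl; linarith
    obtain ⟨b, rfl⟩ := exists_basis w hw
    -- the cut point
    set α := -h (b j) / (h (b i) - h (b j)) with hα
    set β := h (b i) / (h (b i) - h (b j)) with hβ
    have hD : 0 < h (b i) - h (b j) := by linarith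
    have hα0 : 0 < α := div_pos (by linarith) hD
    have hβ0 : 0 < β := div_pos hi hD
    have hαβ : α + β = 1 := by rw [hα, hβ]; field_simp; ring
    have hr : h (α • b i + β • b j) = 0 := by
      have := Convex.combo_affine_apply (f := h) (x := b i) (y := b j) hαβ
      rw [this, hα, hβ, smul_eq_mul, smul_eq_mul]; field_simp; ring
    obtain ⟨A1, B1, C1⟩ := cut_half b i j hij α β hα0 hβ0 hαβ
    obtain ⟨A2, B2, C2⟩ := cut_half b j i hij.symm β α hβ0 hα0 (by linarith)
    rw [add_comm (β • b j)] at A2 B2 C2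
    set r := α • b i + β • b j
    have hcard : ∀ l, h (b l) ≠ 0 →
        (Finset.univ.filter fun k => h (Function.update b l r k) ≠ 0).card ≤ N := by
      intro l hl
      have : (Finset.univ.filter fun k => h (Function.update b l r k) ≠ 0) ⊂
          (Finset.univ.filter fun k => h (b k) ≠ 0) := by
        rw [Finset.ssubset_iff_of_subset]
        · exact ⟨l, by simpa using hl, by simp [hr]⟩
        · intro k hk
          simp only [Finset.mem_filter, Finset.mem_univ, true_and] at hk ⊢
          by_cases hkl : k = l
          · subst hkl; simp [hr] at hk
          · simpa [hkl] using hk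
      have := Finset.card_lt_card this
      omega
    obtain ⟨S1, F1, I1, P1, U1, D1⟩ := ih _ A1 (hcard i hi.ne')
    obtain ⟨S2, F2, I2, P2, U2, D2⟩ := ih _ A2 (hcard j hj.ne)
    have hcross : ∀ u ∈ S1, ∀ u' ∈ S2, interior (convexHull ℝ (Set.range u)) ∩
          interior (convexHull ℝ (Set.range u')) = ∅ := by
      intro u hu u' hu'
      rw [Set.eq_empty_iff_forall_notMem]
      rintro x ⟨hx, hx'⟩
      have s1 : convexHull ℝ (Set.range u) ⊆
          convexHull ℝ (Set.range (Function.update b i r)) := by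
        rw [← U1]; exact Set.subset_biUnion_of_mem (u := fun u => convexHull ℝ (Set.range u)) hu
      have s2 : convexHull ℝ (Set.range u') ⊆
          convexHull ℝ (Set.range (Function.update b j r)) := by
        rw [← U2]; exact Set.subset_biUnion_of_mem (u := fun u => convexHull ℝ (Set.range u)) hu'
      have := C1 x (interior_mono s1 hx)
      have := C2 x (interior_mono s2 hx')
      linarith
    refine ⟨S1 ∪ S2, F1.union F2, ?_, ?_, ?_, ?_⟩
    · rintro u (hu | hu)
      exacts [I1 u hu, I2 u hu]
    · rintro u (hu | hu) u' (hu' | hu') hne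
      · exact P1 hu hu' hne
      · exact hcross u hu u' hu'
      · rw [Set.inter_comm]; exact hcross u' hu' u hu
      · exact P2 hu hu' hne
    · rw [Set.biUnion_union, U1, U2]
      ext x
      rw [Set.mem_union, B1, B2]
      constructor
      · rintro (h | h) <;> exact h.1
      · intro hx
        rcases le_total 0 (α * b.coord j x - β * b.coord i x) with h0 | h0
        · exact Or.inl ⟨hx, h0⟩
        · exact Or.inr ⟨hx, by linarith⟩
    · rintro u (hu | hu)
      exacts [D1 u hu, D2 u hu]

lemma dissect {n : ℕ} (H : Set ((Fin n → ℝ) →ᵃ[ℝ] ℝ)) (hH : H.Finite)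
    (w : Fin (n + 1) → (Fin n → ℝ)) (hw : AffineIndependent ℝ w) : ∃ S, Dissects H w S := by
  induction H, hH using Set.Finite.induction_on with
  | empty =>
    exact ⟨{w}, Set.finite_singleton _, by simpa using hw, by simp, by simp, by simp⟩
  | @insert h H _ _ ih =>
    obtain ⟨S, F, I, P, U, D⟩ := ih
    choose! R hR using fun u hu => dissect_one h _ u (I u hu) le_rfl
    have hsub : ∀ u ∈ S, ∀ t ∈ R u,
        convexHull ℝ (Set.range t) ⊆ convexHull ℝ (Set.range u) := by
      intro u hu t ht
      rw [← (hR u hu).2.2.2.1]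
      exact Set.subset_biUnion_of_mem (u := fun u => convexHull ℝ (Set.range u)) ht
    refine ⟨⋃ u ∈ S, R u, F.biUnion fun u hu => (hR u hu).1, ?_, ?_, ?_, ?_⟩
    · intro t ht
      simp only [Set.mem_iUnion] at ht
      obtain ⟨u, hu, ht⟩ := ht
      exact (hR u hu).2.1 t ht
    · intro t ht t' ht' hne
      simp only [Set.mem_iUnion] at ht ht'
      obtain ⟨u, hu, ht⟩ := ht
      obtain ⟨u', hu', ht'⟩ := ht'
      by_cases huu : u = u'
      · subst huu
        exact (hR u hu).2.2.1 ht ht' hne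
      · have := P hu hu' huu
        dsimp only at this
        rw [Set.eq_empty_iff_forall_notMem] at this ⊢
        rintro x ⟨hx, hx'⟩
        exact this x ⟨interior_mono (hsub u hu t ht) hx, interior_mono (hsub u' hu' t' ht') hx'⟩
    · rw [← U, Set.biUnion_iUnion]
      refine Set.iUnion_congr fun u => ?_
      rw [Set.biUnion_iUnion]
      exact Set.iUnion_congr fun hu => (hR u hu).2.2.2.1
    · intro t ht g hg
      simp only [Set.mem_iUnion] at ht
      obtain ⟨u, hu, ht⟩ := ht
      rcases hg with rfl | hg
      · exact (hR u hu).2.2.2.2 t ht _ rfl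
      · exact (D u hu g hg).imp (fun h x hx => h x (hsub u hu t ht hx))
          (fun h x hx => h x (hsub u hu t ht hx))

/-! ### Piecewise affine functions (finite hyperplane arrangements) -/

/-- `f` is continuous and there are finitely many affine functions `H` such that wherever all of
them have a definite sign, `f` coincides with one of finitely many affine functions. -/
def PWA {d : ℕ} (f : (Fin d → ℝ) → ℝ) : Prop :=
  Continuous f ∧ ∃ H A : Set ((Fin d → ℝ) →ᵃ[ℝ] ℝ), H.Finite ∧ A.Finite ∧
    ∀ C : Set (Fin d → ℝ), (∀ h ∈ H, (∀ x ∈ C, 0 ≤ h x) ∨ (∀ x ∈ C, h x ≤ 0)) →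
      ∃ a ∈ A, ∀ x ∈ C, f x = a x

lemma PWA.affine {d : ℕ} (a : (Fin d → ℝ) →ᵃ[ℝ] ℝ) : PWA (fun x => a x) :=
  ⟨a.continuous_of_finiteDimensional, ∅, {a}, Set.finite_empty, Set.finite_singleton _,
    fun _ _ => ⟨a, rfl, fun _ _ => rfl⟩⟩

lemma PWA.neg {d : ℕ} {f : (Fin d → ℝ) → ℝ} (hf : PWA f) : PWA (fun x => -f x) := by
  obtain ⟨c, H, A, hH, hA, h⟩ := hf
  refine ⟨c.neg, H, (fun a => -a) '' A, hH, hA.image _, fun C hC => ?_⟩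
  obtain ⟨a, ha, h⟩ := h C hC
  exact ⟨-a, ⟨a, ha, rfl⟩, fun x hx => by simp [h x hx]⟩

lemma PWA.add {d : ℕ} {f g : (Fin d → ℝ) → ℝ} (hf : PWA f) (hg : PWA g) :
    PWA (fun x => f x + g x) := by
  obtain ⟨c, H, A, hH, hA, h⟩ := hf
  obtain ⟨c', H', A', hH', hA', h'⟩ := hg
  refine ⟨c.add c', H ∪ H', Set.image2 (fun a a' => a + a') A A', hH.union hH',
    hA.image2 _ hA', fun C hC => ?_⟩
  obtain ⟨a, ha, h⟩ := h C fun k hk => hC k (Or.inl hk)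
  obtain ⟨a', ha', h'⟩ := h' C fun k hk => hC k (Or.inr hk)
  exact ⟨a + a', ⟨a, ha, a', ha', rfl⟩, fun x hx => by simp [h x hx, h' x hx]⟩

lemma PWA.max {d : ℕ} {f g : (Fin d → ℝ) → ℝ} (hf : PWA f) (hg : PWA g) :
    PWA (fun x => max (f x) (g x)) := by
  obtain ⟨c, H, A, hH, hA, h⟩ := hf
  obtain ⟨c', H', A', hH', hA', h'⟩ := hg
  refine ⟨c.max c', (H ∪ H') ∪ Set.image2 (fun a a' => a - a') A A', A ∪ A',
    (hH.union hH').union (hA.image2 _ hA'), hA.union hA', fun C hC => ?_⟩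
  obtain ⟨a, ha, h⟩ := h C fun k hk => hC k (Or.inl (Or.inl hk))
  obtain ⟨a', ha', h'⟩ := h' C fun k hk => hC k (Or.inl (Or.inr hk))
  rcases hC (a - a') (Or.inr ⟨a, ha, a', ha', rfl⟩) with hs | hs
  · refine ⟨a, Or.inl ha, fun x hx => ?_⟩
    have := hs x hx
    simp only [AffineMap.coe_sub, Pi.sub_apply] at this
    dsimp only
    rw [h x hx, h' x hx, max_eq_left (by linarith)]
  · refine ⟨a', Or.inr ha', fun x hx => ?_⟩
    have := hs x hx
    simp only [AffineMap.coe_sub, Pi.sub_apply] at this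
    dsimp only
    rw [h x hx, h' x hx, max_eq_right (by linarith)]

lemma PWA.sup' {d : ℕ} {ι : Type*} (s : Finset ι) (hs : s.Nonempty) (f : ι → (Fin d → ℝ) → ℝ)
    (hf : ∀ i ∈ s, PWA (f i)) : PWA (fun x => s.sup' hs fun i => f i x) := by
  have : PWA (s.sup' hs f) :=
    Finset.sup'_induction hs f (p := PWA) (fun a ha b hb => PWA.max ha hb) hf
  convert this using 1
  funext x
  rw [Finset.sup'_apply]

lemma PWA.min {d : ℕ} {f g : (Fin d → ℝ) → ℝ} (hf : PWA f) (hg : PWA g) :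
    PWA (fun x => min (f x) (g x)) := by
  convert (hf.neg.max hg.neg).neg using 2 with x
  simp [max_neg_neg]

lemma PWA.inf' {d : ℕ} {ι : Type*} (s : Finset ι) (hs : s.Nonempty) (f : ι → (Fin d → ℝ) → ℝ)
    (hf : ∀ i ∈ s, PWA (f i)) : PWA (fun x => s.inf' hs fun i => f i x) := by
  have : PWA (s.inf' hs f) :=
    Finset.inf'_induction hs f (p := PWA) (fun a ha b hb => PWA.min ha hb) hf
  convert this using 1
  funext x
  rw [Finset.inf'_apply]

lemma PWA.sum {d : ℕ} {ι : Type*} (s : Finset ι) (f : ι → (Fin d → ℝ) → ℝ)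
    (hf : ∀ i ∈ s, PWA (f i)) : PWA (fun x => ∑ i ∈ s, f i x) := by
  classical
  induction s using Finset.induction_on with
  | empty => simpa using PWA.affine (0 : (Fin d → ℝ) →ᵃ[ℝ] ℝ)
  | insert a s ha ih =>
    simp_rw [Finset.sum_insert ha]
    exact (hf a (by simp)).add (ih fun i hi => hf i (by simp [hi]))

/-! ### Simplex functions are piecewise affine -/

/-- `x ↦ (x, g x)` as an affine map. -/
def graphMap {d : ℕ} (g : (Fin d → ℝ) →ᵃ[ℝ] ℝ) : (Fin d → ℝ) →ᵃ[ℝ] (Fin (d + 1) → ℝ) where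
  toFun x := Fin.snoc (α := fun _ => ℝ) x (g x)
  linear :=
    { toFun := fun x => Fin.snoc (α := fun _ => ℝ) x (g.linear x)
      map_add' := by
        intro x y; ext i
        refine Fin.lastCases ?_ (fun i => ?_) i <;> simp
      map_smul' := by
        intro c x; ext i
        refine Fin.lastCases ?_ (fun i => ?_) i <;> simp }
  map_vadd' := by
    intro p v; ext i
    refine Fin.lastCases ?_ (fun i => ?_) i
    · simpa using g.map_vadd p v
    · simp

lemma graphMap_apply {d : ℕ} (g : (Fin d → ℝ) →ᵃ[ℝ] ℝ) (x : Fin d → ℝ) :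
    graphMap g x = Fin.snoc (α := fun _ => ℝ) x (g x) := rfl

/-- The vertical unit vector. -/
def eLast (d : ℕ) : Fin (d + 1) → ℝ := Fin.snoc (α := fun _ => ℝ) (0 : Fin d → ℝ) 1

lemma snoc_eq {d : ℕ} (x : Fin d → ℝ) (t : ℝ) :
    (Fin.snoc x t : Fin (d + 1) → ℝ) = t • eLast d + graphMap 0 x := by
  ext i
  refine Fin.lastCases ?_ (fun i => ?_) i <;> simp [eLast, graphMap_apply]

lemma simplexFn_formula {d : ℕ} (v : Fin (d + 2) → (Fin (d + 1) → ℝ)) (hv : IsNondegSimplex d v) :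
    ∃ (β : Fin (d + 2) → (Fin d → ℝ) →ᵃ[ℝ] ℝ) (P N : Finset (Fin (d + 2)))
      (hP : P.Nonempty) (hN : N.Nonempty),
      ∀ x, simplexFn d v x =
        max ((N.inf' hN fun i => β i x) + -(P.sup' hP fun i => β i x)) 0 := by
  classical
  obtain ⟨hv, hnd⟩ := hv
  obtain ⟨b, rfl⟩ := exists_basis v hv
  set c : Fin (d + 2) → ℝ := fun j => (b.coord j).linear (eLast d) with hc
  have hcoord : ∀ j x t, b.coord j (Fin.snoc x t) = c j * t + b.coord j (graphMap 0 x) := by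
    intro j x t
    rw [snoc_eq]
    have := (b.coord j).map_vadd (graphMap 0 x) (t • eLast d)
    simp only [vadd_eq_add, map_smul, smul_eq_mul] at this
    rw [this, hc]; ring
  have hc' : ∀ j, c j = b.coord j (eLast d) - b.coord j 0 := by
    intro j
    have := (b.coord j).linearMap_vsub (eLast d) 0
    simpa [hc] using this
  have hsum : ∑ j, c j = 0 := by
    simp_rw [hc', Finset.sum_sub_distrib, b.sum_coord_apply_eq_one, sub_self]
  have hcomb : ∑ j, c j • b j = eLast d := by
    simp_rw [hc', sub_smul, Finset.sum_sub_distrib, b.linear_combination_coord_eq_self, sub_zero]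
  have hlast : eLast d (Fin.last d) = 1 := by simp [eLast]
  have hne : ∀ j, c j ≠ 0 := by
    intro j hj
    have hz : ∀ k : {k : Fin (d + 2) // k ≠ j}, c k = 0 := by
      have h := hnd j
      rw [affineIndependent_iff] at h
      intro k
      refine h Finset.univ (fun k => c k) ?_ ?_ k (Finset.mem_univ _)
      · have := Fintype.sum_eq_add_sum_subtype_ne c j
        rw [hsum, hj, zero_add] at this
        exact this.symm
      · have := Fintype.sum_eq_add_sum_subtype_ne (fun k => c k • proj d (b k)) j
        rw [hj, zero_smul, zero_add] at this
        rw [← this]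
        ext i
        have h2 := congrFun hcomb i.castSucc
        simp [eLast] at h2
        simpa [proj] using h2
    have : ∀ k, c k = 0 := by
      intro k
      by_cases hk : k = j
      · rw [hk, hj]
      · exact hz ⟨k, hk⟩
    have h2 := congrFun hcomb (Fin.last d)
    rw [hlast] at h2
    simp [this] at h2
  have hPN : (Finset.univ.filter fun j => 0 < c j).Nonempty ∧
      (Finset.univ.filter fun j => c j < 0).Nonempty := by
    constructor
    · by_contra h
      rw [Finset.not_nonempty_iff_eq_empty, Finset.filter_eq_empty_iff] at h
      have : ∑ j, c j < 0 := Finset.sum_neg (fun j _ =>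
        lt_of_le_of_ne (not_lt.1 (h (Finset.mem_univ j))) (hne j)) Finset.univ_nonempty
      linarith
    · by_contra h
      rw [Finset.not_nonempty_iff_eq_empty, Finset.filter_eq_empty_iff] at h
      have : 0 < ∑ j, c j := Finset.sum_pos (fun j _ =>
        lt_of_le_of_ne (not_lt.1 (h (Finset.mem_univ j))) (hne j).symm) Finset.univ_nonempty
      linarith
  set β : Fin (d + 2) → (Fin d → ℝ) →ᵃ[ℝ] ℝ :=
    fun j => (-(c j)⁻¹) • (b.coord j).comp (graphMap 0) with hβ
  have hβx : ∀ j x, β j x = -(c j)⁻¹ * b.coord j (graphMap 0 x) := fun j x => rfl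
  refine ⟨β, _, _, hPN.1, hPN.2, fun x => ?_⟩
  have hset : {t : ℝ | Fin.snoc x t ∈ convexHull ℝ (Set.range b)} =
      Set.Icc ((Finset.univ.filter fun j => 0 < c j).sup' hPN.1 fun i => β i x)
        ((Finset.univ.filter fun j => c j < 0).inf' hPN.2 fun i => β i x) := by
    ext t
    rw [Set.mem_Icc, Finset.sup'_le_iff, Finset.le_inf'_iff, Set.mem_ofPred_eq, hull_eq]
    simp only [Finset.mem_filter, Finset.mem_univ, true_and]
    have e : ∀ j, b.coord j (Fin.snoc x t) = c j * (t - β j x) := by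
      intro j
      rw [hcoord, hβx]
      have := hne j
      field_simp
      ring
    simp_rw [e]
    constructor
    · intro h
      refine ⟨fun j hj => ?_, fun j hj => ?_⟩
      · have := nonneg_of_mul_nonneg_right (h j) hj
        linarith
      · have := nonpos_of_mul_nonneg_right (h j) hj
        linarith
    · rintro ⟨h1, h2⟩ j
      rcases lt_or_gt_of_ne (hne j) with hj | hj
      · exact mul_nonneg_of_nonpos_of_nonpos hj.le (by linarith [h2 j hj])
      · exact mul_nonneg hj.le (by linarith [h1 j hj])
  rw [simplexFn, hset, Real.volume_Icc, ENNReal.toReal_ofReal', sub_eq_add_neg]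

lemma simplexFn_PWA {d : ℕ} (v : Fin (d + 2) → (Fin (d + 1) → ℝ)) (hv : IsNondegSimplex d v) :
    PWA (simplexFn d v) := by
  obtain ⟨β, P, N, hP, hN, h⟩ := simplexFn_formula v hv
  rw [show simplexFn d v = _ from funext h]
  refine PWA.max (PWA.add (PWA.inf' _ _ _ fun i _ => PWA.affine _)
    (PWA.neg (PWA.sup' _ _ _ fun i _ => PWA.affine _))) ?_
  exact PWA.affine (0 : (Fin d → ℝ) →ᵃ[ℝ] ℝ)

lemma simplexFn_support {d : ℕ} (v : Fin (d + 2) → (Fin (d + 1) → ℝ)) :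
    HasCompactSupport (simplexFn d v) := by
  have hpc : Continuous (proj d) := by unfold proj; fun_prop
  have hK : IsCompact (proj d '' convexHull ℝ (Set.range v)) :=
    ((Set.finite_range v).isCompact_convexHull (𝕜 := ℝ)).image hpc
  refine HasCompactSupport.intro hK fun x hx => ?_
  have : {t : ℝ | Fin.snoc x t ∈ convexHull ℝ (Set.range v)} = ∅ := by
    rw [Set.eq_empty_iff_forall_notMem]
    intro t ht
    refine hx ⟨_, ht, ?_⟩
    ext i; simp [proj]
  rw [simplexFn, this]; simp

lemma big_simplex {d : ℕ} (K : Set (Fin d → ℝ)) (hK : IsCompact K) :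
    ∃ w : Fin (d + 1) → (Fin d → ℝ), AffineIndependent ℝ w ∧ K ⊆ convexHull ℝ (Set.range w) := by
  obtain ⟨R, hR⟩ := hK.isBounded.exists_norm_le
  set M : ℝ := 2 * |R| * d + 1 with hM
  have hM0 : 0 < M := by positivity
  set w : Fin (d + 1) → (Fin d → ℝ) :=
    Fin.cons (fun _ => -|R|) (fun k => (fun _ => -|R|) + M • Pi.single k 1) with hw
  refine ⟨w, affInd_of _ fun μ h0 h1 => ?_, fun x hx => ?_⟩
  · have hs : ∀ k : Fin d, μ k.succ = 0 := by
      intro k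
      have := congrFun h1 k
      simp only [Finset.sum_apply, Pi.smul_apply, smul_eq_mul, Fin.sum_univ_succ, hw, Fin.cons_zero,
        Fin.cons_succ, Pi.add_apply, mul_add, Finset.sum_add_distrib, Pi.zero_apply,
        Pi.single_apply, mul_ite, mul_one, mul_zero, Finset.sum_ite_eq, Finset.mem_univ, if_true,
        ← Finset.sum_mul] at this
      rw [Fin.sum_univ_succ] at h0
      have h3 : μ k.succ * M = 0 := by linear_combination this + |R| * h0
      exact (mul_eq_zero.1 h3).resolve_right hM0.ne'
    intro i
    refine Fin.cases ?_ hs i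
    rw [Fin.sum_univ_succ] at h0
    simpa [hs] using h0
  · have hxk : ∀ k, |x k| ≤ |R| := fun k =>
      ((norm_le_pi_norm x k).trans (hR x hx)).trans (le_abs_self R)
    set μ : Fin (d + 1) → ℝ := Fin.cons (1 - ∑ k, (x k + |R|) / M) (fun k => (x k + |R|) / M)
      with hμ
    have hx' : x = ∑ k, μ k • w k := by
      ext k
      simp only [Finset.sum_apply, Pi.smul_apply, smul_eq_mul, Fin.sum_univ_succ, hw, hμ,
        Fin.cons_zero,
        Fin.cons_succ, Pi.add_apply, mul_add, Finset.sum_add_distrib,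
        Pi.single_apply, mul_ite, mul_one, mul_zero, Finset.sum_ite_eq, Finset.mem_univ, if_true,
        ← Finset.sum_mul]
      field_simp
      ring
    rw [hx']
    refine (convex_convexHull ℝ (Set.range w)).sum_mem ?_ ?_
      (fun i _ => subset_convexHull ℝ _ ⟨i, rfl⟩)
    · intro i _
      refine Fin.cases ?_ (fun k => ?_) i
      · simp only [hμ, Fin.cons_zero, ← Finset.sum_div, sub_nonneg]
        rw [div_le_one hM0]
        have : ∑ k : Fin d, (x k + |R|) ≤ ∑ k : Fin d, (2 * |R|) :=
          Finset.sum_le_sum fun k _ => by linarith [le_abs_self (x k), hxk k]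
        simp only [Finset.sum_const, Finset.card_univ, Fintype.card_fin, nsmul_eq_mul] at this
        linarith
      · simp only [hμ, Fin.cons_succ]
        have : 0 ≤ x k + |R| := by linarith [neg_abs_le (x k), hxk k]
        positivity
    · rw [Fin.sum_univ_succ]; simp [hμ]

lemma isPL_of_PWA {d : ℕ} (f : (Fin d → ℝ) → ℝ) (hf : PWA f) (hs : HasCompactSupport f) :
    ∃ n, IsPL d n f := by
  obtain ⟨hc, H, A, hH, hA, h⟩ := hf
  obtain ⟨w, hw, hKw⟩ := big_simplex _ hs.isCompact
  obtain ⟨S, F, I, P, U, D⟩ := dissect H hH w hw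
  have : Finite S := F
  obtain ⟨n, ⟨e⟩⟩ := Finite.exists_equiv_fin S
  refine ⟨n, hc, hs, n, le_rfl, fun i => (e.symm i : Fin (d + 1) → (Fin d → ℝ)),
    fun i => I _ (e.symm i).2, ?_, ?_, ?_⟩
  · intro i j hij
    refine P (e.symm i).2 (e.symm j).2 fun h => hij ?_
    exact e.symm.injective (Subtype.ext h)
  · intro i
    obtain ⟨a, _, ha⟩ := h _ (D _ (e.symm i).2)
    exact ⟨a, ha⟩
  · intro x hx
    by_contra hfx
    apply hx
    have hxw := hKw (subset_tsupport f hfx)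
    rw [← U] at hxw
    simp only [Set.mem_iUnion] at hxw ⊢
    obtain ⟨u, hu, hxu⟩ := hxw
    exact ⟨e ⟨u, hu⟩, by simpa using hxu⟩

lemma backward {d : ℕ} (f : (Fin d → ℝ) → ℝ) (m : ℕ) (v : Fin m → Fin (d + 2) → (Fin (d + 1) → ℝ))
    (ε : Fin m → ℝ) (hv : ∀ i, IsNondegSimplex d (v i)) (hε : ∀ i, ε i = 1 ∨ ε i = -1)
    (hf : ∀ x : Fin d → ℝ, f x = ∑ i, ε i * simplexFn d (v i) x) : ∃ n, IsPL d n f := by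
  rw [show f = _ from funext hf]
  refine isPL_of_PWA _ (PWA.sum _ _ fun i _ => ?_) ?_
  · rcases hε i with h | h
    · simpa [h] using simplexFn_PWA _ (hv i)
    · simpa [h] using (simplexFn_PWA _ (hv i)).neg
  · have : ∀ s : Finset (Fin m), HasCompactSupport
        (fun x => ∑ i ∈ s, ε i * simplexFn d (v i) x) := by
      classical
      intro s
      induction s using Finset.induction_on with
      | empty =>
        simp only [Finset.sum_empty]
        exact (HasCompactSupport.zero : HasCompactSupport (0 : (Fin d → ℝ) → ℝ))
      | insert a s ha ih =>
        simp_rw [Finset.sum_insert ha]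
        exact HasCompactSupport.add ((simplexFn_support (v a)).mul_left (f := fun _ => ε a)) ih
    exact this _

/-! ### Cones over graphs -/

/-- Parameters `s ∈ [0,1]` for which `x` lies on `(1-s) p + s C`. -/
def coneSet {d : ℕ} (p : Fin d → ℝ) (C : Set (Fin d → ℝ)) (x : Fin d → ℝ) : Set ℝ :=
  {s | s ∈ Set.Icc (0 : ℝ) 1 ∧ ∃ y ∈ C, x = (1 - s) • p + s • y}

/-- The vertices of the cone with apex `(p, 0)` over the graph of `g` on the simplex `w`. -/
def coneVert {d : ℕ} (p : Fin d → ℝ) (w : Fin (d + 1) → (Fin d → ℝ)) (g : (Fin d → ℝ) →ᵃ[ℝ] ℝ) :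
    Fin (d + 2) → (Fin (d + 1) → ℝ) :=
  Fin.cons (graphMap 0 p) (fun k => graphMap g (w k))

lemma coneSet_closed {d : ℕ} (p : Fin d → ℝ) (C : Set (Fin d → ℝ)) (hC : IsCompact C)
    (x : Fin d → ℝ) : IsClosed (coneSet p C x) := by
  have h1 : IsCompact ((Set.Icc (0 : ℝ) 1 ×ˢ C) ∩
      {q : ℝ × (Fin d → ℝ) | x = (1 - q.1) • p + q.1 • q.2}) := by
    refine (isCompact_Icc.prod hC).inter_right ?_
    exact isClosed_eq (by fun_prop) (by fun_prop)
  have h2 : coneSet p C x = Prod.fst '' ((Set.Icc (0 : ℝ) 1 ×ˢ C) ∩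
      {q : ℝ × (Fin d → ℝ) | x = (1 - q.1) • p + q.1 • q.2}) := by
    ext s
    constructor
    · rintro ⟨hs, y, hy, h⟩
      exact ⟨(s, y), ⟨⟨hs, hy⟩, h⟩, rfl⟩
    · rintro ⟨⟨s, y⟩, ⟨⟨hs, hy⟩, h⟩, rfl⟩
      exact ⟨hs, y, hy, h⟩
  rw [h2]
  exact (h1.image continuous_fst).isClosed

open scoped Pointwise in
lemma simplexFn_cone {d : ℕ} (p : Fin d → ℝ) (w : Fin (d + 1) → (Fin d → ℝ))
    (g : (Fin d → ℝ) →ᵃ[ℝ] ℝ) (x : Fin d → ℝ) :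
    simplexFn d (coneVert p w g) x =
      |g p| * (volume (coneSet p (convexHull ℝ (Set.range w)) x)).toReal := by
  have hset : {t : ℝ | Fin.snoc x t ∈ convexHull ℝ (Set.range (coneVert p w g))} =
      (fun t => (g x - g p) + t) ''
        (g p • coneSet p (convexHull ℝ (Set.range w)) x) := by
    have hr : Set.range (coneVert p w g) =
        insert (graphMap 0 p) (graphMap g '' Set.range w) := by
      rw [coneVert, Fin.range_cons, ← Set.range_comp]; rfl
    rw [hr, convexHull_insert ((Set.range_nonempty w).image _), ← AffineMap.image_convexHull]
    ext t
    simp only [Set.mem_ofPred_eq, mem_convexJoin, Set.mem_singleton_iff, exists_eq_left,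
      Set.mem_image, exists_exists_and_eq_and, Set.mem_smul_set]
    have hcomb : ∀ s y, (1 - s) • graphMap 0 p + s • graphMap g y =
        (Fin.snoc ((1 - s) • p + s • y) (s * g y) : Fin (d + 1) → ℝ) := by
      intro s y
      ext i
      refine Fin.lastCases ?_ (fun i => ?_) i <;> simp [graphMap_apply]
    have hg : ∀ (s : ℝ) y, g ((1 - s) • p + s • y) = (1 - s) * g p + s * g y := by
      intro s y
      have := Convex.combo_affine_apply (f := g) (x := p) (y := y) (sub_add_cancel 1 s)
      simpa using this
    constructor
    · rintro ⟨y, hy, hseg⟩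
      rw [segment_eq_image] at hseg
      obtain ⟨s, hs, h⟩ := hseg
      dsimp only at h
      rw [hcomb] at h
      obtain ⟨h1, h2⟩ := Fin.snoc_inj.1 h
      refine ⟨s, ⟨hs, y, hy, h1.symm⟩, ?_⟩
      rw [← h1, hg, ← h2, smul_eq_mul]; ring
    · rintro ⟨s, ⟨hs, y, hy, h1⟩, h2⟩
      refine ⟨y, hy, ?_⟩
      rw [segment_eq_image]
      refine ⟨s, hs, ?_⟩
      dsimp only
      rw [hcomb, ← h1]
      congr 1
      rw [h1, hg, smul_eq_mul] at h2
      linarith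
  rw [simplexFn, hset, Set.image_add_left, measure_preimage_add, Measure.addHaar_smul]
  simp [ENNReal.toReal_mul]

lemma coneVert_nondeg {d : ℕ} (p : Fin d → ℝ) (b : AffineBasis (Fin (d + 1)) ℝ (Fin d → ℝ))
    (g : (Fin d → ℝ) →ᵃ[ℝ] ℝ) (hg : g p ≠ 0) (hp : ∀ k, b.coord k p ≠ 0) :
    IsNondegSimplex d (coneVert p b g) := by
  classical
  have hproj : ∀ (g : (Fin d → ℝ) →ᵃ[ℝ] ℝ) x, proj d (graphMap g x) = x := by
    intro g x; ext i; simp [proj, graphMap_apply]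
  have p0 : proj d (coneVert p b g 0) = p := by
    rw [coneVert, Fin.cons_zero, hproj]
  have ps : ∀ k : Fin (d + 1), proj d (coneVert p b g k.succ) = b k := by
    intro k; rw [coneVert, Fin.cons_succ, hproj]
  have key : ∀ μ : Fin (d + 2) → ℝ, ∑ j, μ j = 0 → ∑ j, μ j • proj d (coneVert p b g j) = 0 →
      (∀ φ : (Fin d → ℝ) →ᵃ[ℝ] ℝ, μ 0 * φ p + ∑ k : Fin (d + 1), μ k.succ * φ (b k) = 0) := by
    intro μ h0 h1 φ
    have := aff_sum φ μ (fun j => proj d (coneVert p b g j))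
    rw [h0, h1, Fin.sum_univ_succ] at this
    simp_rw [p0, ps] at this
    simpa using this
  have key2 : ∀ μ : Fin (d + 2) → ℝ, ∑ j, μ j = 0 → ∑ j, μ j • proj d (coneVert p b g j) = 0 →
      ∀ k : Fin (d + 1), μ 0 * b.coord k p + μ k.succ = 0 := by
    intro μ h0 h1 k
    have := key μ h0 h1 (b.coord k)
    simpa [b.coord_apply] using this
  have key3 : ∀ μ : Fin (d + 2) → ℝ, ∑ j, μ j = 0 → ∑ j, μ j • proj d (coneVert p b g j) = 0 →
      μ 0 = 0 → ∀ j, μ j = 0 := by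
    intro μ h0 h1 h2 j
    refine Fin.cases h2 (fun k => ?_) j
    have := key2 μ h0 h1 k
    rw [h2] at this
    linarith
  refine ⟨affInd_of _ fun μ h0 h1 => ?_, fun i => ?_⟩
  · have h1' : ∑ j, μ j • proj d (coneVert p b g j) = 0 := by
      ext i
      have := congrFun h1 i.castSucc
      simpa [proj] using this
    refine key3 μ h0 h1' ?_
    have hl := congrFun h1 (Fin.last d)
    simp only [coneVert, graphMap_apply, Fin.sum_univ_succ, Finset.sum_apply, Pi.smul_apply,
      Fin.cons_zero, Fin.cons_succ, Fin.snoc_last, smul_eq_mul, Pi.zero_apply] at hl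
    have h3 := key μ h0 h1' g
    rw [Fin.sum_univ_succ] at h3
    simp only [AffineMap.coe_zero, Pi.zero_apply, mul_zero, zero_add] at hl
    rw [hl, add_zero] at h3
    exact (mul_eq_zero.1 h3).resolve_right hg
  · refine affInd_of _ fun μ h0 h1 => ?_
    set ν : Fin (d + 2) → ℝ := fun j => if h : j ≠ i then μ ⟨j, h⟩ else 0 with hν
    have hνi : ν i = 0 := by simp [hν]
    have hνj : ∀ j : {j // j ≠ i}, ν j = μ j := by
      intro j; simp only [hν]; rw [dif_pos j.2]
    have e0 : ∑ j, ν j = 0 := by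
      rw [Fintype.sum_eq_add_sum_subtype_ne ν i, hνi, zero_add]
      simp_rw [hνj]; exact h0
    have e1 : ∑ j, ν j • proj d (coneVert p b g j) = 0 := by
      rw [Fintype.sum_eq_add_sum_subtype_ne (fun j => ν j • proj d (coneVert p b g j)) i, hνi,
        zero_smul, zero_add]
      simp_rw [hνj]; exact h1
    have hν0 : ν 0 = 0 := by
      revert hνi
      refine Fin.cases (fun h => h) (fun k h => ?_) i
      have := key2 ν e0 e1 k
      rw [h, add_zero] at this
      exact (mul_eq_zero.1 this).resolve_right (hp k)
    intro j
    rw [← hνj]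
    exact key3 ν e0 e1 hν0 j

/-! ### Forward direction -/

lemma generic_point {d m : ℕ} (b : Fin m → AffineBasis (Fin (d + 1)) ℝ (Fin d → ℝ)) :
    ∃ p : Fin d → ℝ, ∀ i k, (b i).coord k p ≠ 0 := by
  by_contra hcon
  push Not at hcon
  have hnull : ∀ i k, volume {p : Fin d → ℝ | (b i).coord k p = 0} = 0 := by
    intro i k
    let A : AffineSubspace ℝ (Fin d → ℝ) :=
      (AffineSubspace.mk' (0 : ℝ) ⊥).comap ((b i).coord k)
    have hA : (A : Set (Fin d → ℝ)) = {p : Fin d → ℝ | (b i).coord k p = 0} := by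
      ext p
      simp [A]
    rw [← hA]
    refine Measure.addHaar_affineSubspace _ _ fun h => ?_
    have h1 : b i k ∈ (A : Set (Fin d → ℝ)) := by rw [h]; trivial
    rw [hA] at h1
    simp at h1
  have : volume (⋃ i, ⋃ k, {p : Fin d → ℝ | (b i).coord k p = 0}) = 0 :=
    measure_iUnion_null fun i => measure_iUnion_null fun k => hnull i k
  have hu : (⋃ i, ⋃ k, {p : Fin d → ℝ | (b i).coord k p = 0}) = Set.univ := by
    rw [Set.eq_univ_iff_forall]
    intro p
    obtain ⟨i, k, h⟩ := hcon p
    simp only [Set.mem_iUnion]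
    exact ⟨i, k, h⟩
  rw [hu] at this
  exact (Measure.measure_univ_ne_zero.2 (NeZero.ne _)) this

lemma aff_line {d : ℕ} (g : (Fin d → ℝ) →ᵃ[ℝ] ℝ) (p x : Fin d → ℝ) (s : ℝ) (hs : s ≠ 0) :
    s * g (p + s⁻¹ • (x - p)) = s * g p + (g x - g p) := by
  have h : ∀ x, g x = g.linear x + g 0 := fun x => congrFun g.decomp x
  rw [h (p + _), h p, h x, map_add, map_smul, map_sub, smul_eq_mul]
  field_simp
  ring

lemma key_formula {d m : ℕ} (f : (Fin d → ℝ) → ℝ) (hc : Continuous f) (hs : HasCompactSupport f)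
    (b : Fin m → AffineBasis (Fin (d + 1)) ℝ (Fin d → ℝ))
    (hdisj : Pairwise fun i j => interior (convexHull ℝ (Set.range (b i))) ∩
          interior (convexHull ℝ (Set.range (b j))) = ∅)
    (g : Fin m → (Fin d → ℝ) →ᵃ[ℝ] ℝ)
    (hg : ∀ i, ∀ x ∈ convexHull ℝ (Set.range (b i)), f x = g i x)
    (h0 : ∀ x : Fin d → ℝ, x ∉ ⋃ i, convexHull ℝ (Set.range (b i)) → f x = 0)
    (p : Fin d → ℝ) (hp : ∀ i k, (b i).coord k p ≠ 0) (x : Fin d → ℝ) :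
    f x = ∑ i, g i p * (volume (coneSet p (convexHull ℝ (Set.range (b i))) x)).toReal := by
  classical
  set I : Fin m → Set ℝ := fun i => coneSet p (convexHull ℝ (Set.range (b i))) x with hI
  have hcpt : ∀ i, IsCompact (convexHull ℝ (Set.range (b i))) := fun i =>
    (Set.finite_range _).isCompact_convexHull (𝕜 := ℝ)
  have hIm : ∀ i, MeasurableSet (I i) := fun i => (coneSet_closed p _ (hcpt i) x).measurableSet
  have hIs : ∀ i, I i ⊆ Set.Icc 0 1 := fun i s hs => hs.1
  set φ : ℝ → ℝ := fun s => s * f (p + s⁻¹ • (x - p)) with hφ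
  set φ' : ℝ → ℝ := fun s => ∑ i, (I i).indicator (fun _ => g i p) s with hφ'
  set Z : Set ℝ := ⋃ i, ⋃ k, {s : ℝ | s * (b i).coord k p + ((b i).coord k x - (b i).coord k p) = 0}
    with hZ
  have hZc : Z.Countable := by
    refine Set.countable_iUnion fun i => Set.countable_iUnion fun k => ?_
    refine Set.Subsingleton.countable ?_
    intro s hs t ht
    have e1 : s * (b i).coord k p + ((b i).coord k x - (b i).coord k p) = 0 := hs
    have e2 : t * (b i).coord k p + ((b i).coord k x - (b i).coord k p) = 0 := ht
    exact mul_right_cancel₀ (hp i k) (by linarith)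
  have hcy : ∀ s : ℝ, s ≠ 0 → ContinuousAt (fun s : ℝ => p + s⁻¹ • (x - p)) s := by
    intro s hs
    exact continuousAt_const.add ((continuousAt_inv₀ hs).smul continuousAt_const)
  have hφc : Continuous φ := by
    rw [continuous_iff_continuousAt]
    intro s
    by_cases h : s = 0
    · subst h
      obtain ⟨B, hB⟩ := hs.exists_bound_of_continuous hc
      have : Filter.Tendsto φ (nhds 0) (nhds 0) := by
        refine squeeze_zero_norm (a := fun s : ℝ => |s| * B) (fun s => ?_) ?_
        · rw [hφ, norm_mul]
          exact mul_le_mul_of_nonneg_left (hB _) (abs_nonneg _)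
        · have : Continuous fun s : ℝ => |s| * B := by fun_prop
          simpa using this.tendsto 0
      simpa [ContinuousAt, hφ] using this
    · exact continuousAt_id.mul (ContinuousAt.comp (g := f) hc.continuousAt (hcy s h))
  have hmem : ∀ s ∈ Set.Ioo (0 : ℝ) 1, ∀ i,
      s ∈ I i ↔ p + s⁻¹ • (x - p) ∈ convexHull ℝ (Set.range (b i)) := by
    intro s hs i
    have hs0 : s ≠ 0 := hs.1.ne'
    constructor
    · rintro ⟨_, y, hy, h⟩
      have : p + s⁻¹ • (x - p) = y := by
        rw [h]; ext k; simp; field_simp; ring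
      rwa [this]
    · intro h
      refine ⟨⟨hs.1.le, hs.2.le⟩, _, h, ?_⟩
      ext k; simp; field_simp; ring
  have hder : ∀ s ∈ Set.Ioo (0 : ℝ) 1 \ Z, HasDerivAt φ (φ' s) s := by
    rintro s ⟨hs, hsZ⟩
    have hs0 : s ≠ 0 := hs.1.ne'
    set y := p + s⁻¹ • (x - p) with hy
    have hyne : ∀ i k, (b i).coord k y ≠ 0 := by
      intro i k h
      apply hsZ
      simp only [hZ, Set.mem_iUnion]
      refine ⟨i, k, ?_⟩
      have := aff_line ((b i).coord k) p x s hs0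
      rw [← hy, h, mul_zero] at this
      exact this.symm
    have hInter : ∀ i, y ∈ convexHull ℝ (Set.range (b i)) →
        y ∈ interior (convexHull ℝ (Set.range (b i))) := by
      intro i h
      rw [hull_eq] at h
      rw [int_hull_eq]
      exact fun k => lt_of_le_of_ne (h k) (hyne i k).symm
    by_cases hex : ∃ i, y ∈ convexHull ℝ (Set.range (b i))
    · obtain ⟨i, hi⟩ := hex
      have hval : φ' s = g i p := by
        rw [hφ']
        dsimp only
        rw [Finset.sum_eq_single i]
        · rw [Set.indicator_of_mem ((hmem s hs i).2 hi)]
        · intro j _ hji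
          apply Set.indicator_of_notMem
          intro hj
          have hj' := hInter j ((hmem s hs j).1 hj)
          have := hdisj hji
          exact (Set.eq_empty_iff_forall_notMem.1 this) y ⟨hj', hInter i hi⟩
        · simp
      rw [hval]
      have hev : φ =ᶠ[nhds s] fun t => t * g i p + (g i x - g i p) := by
        have h1 := (hcy s hs0).eventually (isOpen_interior.mem_nhds (hInter i hi))
        filter_upwards [h1, isOpen_ne.mem_nhds hs0] with t ht ht0
        rw [hφ]
        dsimp only
        rw [hg i _ (interior_subset ht), aff_line _ _ _ _ ht0]
      refine HasDerivAt.congr_of_eventuallyEq ?_ hev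
      simpa using ((hasDerivAt_id s).mul_const (g i p)).add_const (g i x - g i p)
    · push Not at hex
      have hval : φ' s = 0 := by
        rw [hφ']
        refine Finset.sum_eq_zero fun i _ => Set.indicator_of_notMem (fun hi => ?_) _
        exact hex i ((hmem s hs i).1 hi)
      rw [hval]
      have hcl : IsClosed (⋃ i, convexHull ℝ (Set.range (b i))) :=
        isClosed_iUnion_of_finite fun i => (hcpt i).isClosed
      have hyn : y ∈ (⋃ i, convexHull ℝ (Set.range (b i)))ᶜ := by simpa using hex
      have hev : φ =ᶠ[nhds s] fun _ => 0 := by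
        have h1 := (hcy s hs0).eventually (hcl.isOpen_compl.mem_nhds hyn)
        filter_upwards [h1] with t ht
        rw [hφ]
        dsimp only
        rw [h0 _ ht, mul_zero]
      exact HasDerivAt.congr_of_eventuallyEq (hasDerivAt_const s 0) hev
  have hIntble : ∀ i, Integrable ((I i).indicator (fun _ => g i p)) volume := by
    intro i
    rw [integrable_indicator_iff (hIm i)]
    refine integrableOn_const ?_
    exact ((measure_mono (hIs i)).trans_lt measure_Icc_lt_top).ne
  have hφ'i : IntervalIntegrable φ' volume 0 1 :=
    (integrable_finsetSum _ fun i _ => hIntble i).intervalIntegrable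
  have hFTC := integral_eq_of_hasDerivAt_off_countable_of_le φ φ' zero_le_one hZc
    hφc.continuousOn hder hφ'i
  have hφ1 : φ 1 - φ 0 = f x := by simp [hφ]
  rw [hφ1] at hFTC
  rw [← hFTC, intervalIntegral.integral_of_le zero_le_one, ← integral_Icc_eq_integral_Ioc, hφ',
    integral_finsetSum _ fun i _ => (hIntble i).integrableOn]
  refine Finset.sum_congr rfl fun i _ => ?_
  rw [setIntegral_indicator (hIm i), Set.inter_eq_right.2 (hIs i), setIntegral_const, smul_eq_mul,
    mul_comm]
  rfl

lemma forward {d n : ℕ} (f : (Fin d → ℝ) → ℝ) (hf : IsPL d n f) :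
      ∃ (m : ℕ) (v : Fin m → Fin (d + 2) → (Fin (d + 1) → ℝ)) (ε : Fin m → ℝ),
        (∀ i, IsNondegSimplex d (v i)) ∧
        (∀ i, ε i = 1 ∨ ε i = -1) ∧
        (∀ x : Fin d → ℝ, f x = ∑ i, ε i * simplexFn d (v i) x) := by
  classical
  obtain ⟨hc, hs, m, _, w, hw, hdisj, hg, h0⟩ := hf
  choose b hb using fun i => exists_basis (w i) (hw i)
  obtain rfl : (fun i => ⇑(b i)) = w := funext hb
  choose g hg using hg
  obtain ⟨p, hp⟩ := generic_point b
  have key := key_formula f hc hs b hdisj g hg h0 p hp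
  let J := {i : Fin m // g i p ≠ 0}
  let e : J ≃ Fin (Fintype.card J) := Fintype.equivFin J
  refine ⟨Fintype.card J, fun j => coneVert p (b (e.symm j).1) (g (e.symm j).1),
    fun j => SignType.sign (g (e.symm j).1 p), fun j => ?_, fun j => ?_, fun x => ?_⟩
  · exact coneVert_nondeg p _ _ (e.symm j).2 (hp _)
  · rcases lt_or_gt_of_ne (e.symm j).2 with h | h
    · right; simp [sign_neg h]
    · left; simp [sign_pos h]
  · rw [key x, Equiv.sum_comp e.symm (fun j : J =>
      ((SignType.sign (g j.1 p) : SignType) : ℝ) * simplexFn d (coneVert p (b j.1) (g j.1)) x)]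
    simp_rw [simplexFn_cone, ← mul_assoc, sign_mul_abs]
    rw [← Finset.sum_filter_of_ne (p := fun i => g i p ≠ 0)
      (fun i _ h h' => h (by rw [h', zero_mul]))]
    exact Finset.sum_subtype _ (by simp) _

/-- A function `f : ℝ^d → ℝ` is a continuous compactly supported piecewise affine function
(i.e. `f ∈ PL(d,n)` for some `n`) if and only if `f` is a finite signed sum of simplex
functions of nondegenerate `(d+1)`-simplices. -/
theorem isPL_iff_signed_sum_simplexFn (d : ℕ) (f : (Fin d → ℝ) → ℝ) :
    (∃ n : ℕ, IsPL d n f) ↔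
      ∃ (m : ℕ) (v : Fin m → Fin (d + 2) → (Fin (d + 1) → ℝ)) (ε : Fin m → ℝ),
        (∀ i, IsNondegSimplex d (v i)) ∧
        (∀ i, ε i = 1 ∨ ε i = -1) ∧
        (∀ x : Fin d → ℝ, f x = ∑ i, ε i * simplexFn d (v i) x) := by
  constructor
  · rintro ⟨n, hf⟩
    exact forward f hf
  · rintro ⟨m, v, ε, hv, hε, hf⟩
    exact backward f m v ε hv hε hf
end
end
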